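/- There exists a constant C′ > 0 (depending only on m, β and the probability weight p) such that for every n ≥ 2 and every triple (x₀, x₁, x₂) = (a_{n,j}, a_{n,j+1}, a_{n,j+2}) in X_n with 0 ≤ j ≤ #X_n − 3, one has C′·(W_n(x₀) + W_n(x₁)) ≤ μ_p([x₁, x₂]) ≤ W_n(x₀) + W_n(x₁). -/

import Mathlib

open MeasureTheory

noncomputable section

/-- The contraction maps: `Smap β 0 = S₁ : x ↦ x/β` and `Smap β 1 = S₂ : x ↦ x/β + (1 - 1/β)`. -/
def Smap (β : ℝ) (i : Fin 2) (x : ℝ) : ℝ :=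
  if i = 0 then x / β else x / β + (1 - 1 / β)

/-- `Sapply β I = S_I = S_{i₁} ∘ ⋯ ∘ S_{i_n}` for a word `I = i₁…i_n ∈ {1,2}^n`. -/
def Sapply (β : ℝ) : {n : ℕ} → (Fin n → Fin 2) → ℝ → ℝ
  | 0, _, x => x
  | _+1, I, x => Smap β (I 0) (Sapply β (fun k => I k.succ) x)

/-- `Xn β n = {S_I(0) : I ∈ {1,2}^n} ∪ {1}`. -/
def Xn (β : ℝ) (n : ℕ) : Finset ℝ :=
  (Finset.univ.image fun I : Fin n → Fin 2 => Sapply β I 0) ∪ {1}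

/-- `pt β n j = a_{n,j}`, the `j`-th element of `Xn β n` in increasing order
(junk value `0` if `j` is out of range). -/
def pt (β : ℝ) (n j : ℕ) : ℝ := ((Xn β n).sort (· ≤ ·)).getD j 0

/-- The sequence `d₀ = 1`, `d₁ = β - 1`, `d_{j+1} = β·d_j - d₁`. -/
def dd (β : ℝ) : ℕ → ℝ
  | 0 => 1
  | 1 => β - 1
  | j+2 => β * dd β (j+1) - (β - 1)

/-- The weight of a letter: `pw p₁ p₂ i = p_{i+1}`. -/
def pw (p1 p2 : ℝ) (i : Fin 2) : ℝ := if i = 0 then p1 else p2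

/-- `Wn β p₁ p₂ n x = W_n(x) = ∑_{S_I(0)=x, |I|=n} p_I`. -/
def Wn (β p1 p2 : ℝ) (n : ℕ) (x : ℝ) : ℝ :=
  ∑ I : Fin n → Fin 2, if Sapply β I 0 = x then ∏ k, pw p1 p2 (I k) else 0

/-- A measure with support `[0,1]` is doubling if
`sup { μ(B(x,2r))/μ(B(x,r)) : x ∈ supp μ = [0,1], r > 0 } < ∞`. -/
def IsDoubling (μ : Measure ℝ) : Prop :=
  (⨆ (x : ℝ) (_ : x ∈ Set.Icc (0:ℝ) 1) (r : ℝ) (_ : 0 < r),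
    μ (Metric.closedBall x (2 * r)) / μ (Metric.closedBall x r)) < ⊤


/-- Scaled point sets: `Ys β n = β^n · {S_I(0)}`, defined by adding the lowest digit. -/
def Ys (β : ℝ) : ℕ → Set ℝ
  | 0 => {0}
  | n+1 => {y | ∃ x ∈ Ys β n, y = β * x ∨ y = β * x + (β - 1)}

theorem golden_le (m : ℕ) (hm : 2 ≤ m) (β : ℝ) (hβ1 : 1 < β)
    (hβ : β ^ m = ∑ j ∈ Finset.range m, β ^ j) : β + 1 ≤ β ^ 2 := by
  obtain ⟨k, rfl⟩ : ∃ k, m = k + 2 := ⟨m - 2, by omega⟩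
  rw [Finset.sum_range_succ, Finset.sum_range_succ] at hβ
  have h0 : 0 ≤ ∑ j ∈ Finset.range k, β ^ j := Finset.sum_nonneg fun _ _ => by positivity
  have hk : 0 < β ^ k := by positivity
  have : β ^ k * (β + 1) ≤ β ^ k * β ^ 2 := by
    have e1 : β ^ (k + 2) = β ^ k * β ^ 2 := by ring
    have e2 : β ^ (k + 1) = β ^ k * β := by ring
    rw [e1, e2] at hβ
    linarith
  exact le_of_mul_le_mul_left this hk

theorem beta_sub_one (m : ℕ) (β : ℝ) (hβ1 : 1 < β)
    (hβ : β ^ m = ∑ j ∈ Finset.range m, β ^ j) : β - 1 = 1 - (β⁻¹) ^ m := by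
  have h := geom_sum_mul β m
  rw [← hβ] at h
  have hk : 0 < β ^ m := by positivity
  rw [inv_pow]
  field_simp
  linarith

theorem Ys_bound (β : ℝ) (hβ1 : 1 < β) (n : ℕ) :
    ∀ x ∈ Ys β n, 0 ≤ x ∧ x ≤ β ^ n - 1 := by
  induction n with
  | zero => intro x hx; simp [Ys] at hx; simp [hx]
  | succ n ih =>
    rintro x ⟨y, hy, h⟩
    obtain ⟨h0, h1⟩ := ih y hy
    have e : β ^ (n + 1) = β * β ^ n := by ring
    rw [e]
    rcases h with rfl | rfl
    · constructor
      · positivity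
      · nlinarith
    · constructor
      · nlinarith
      · nlinarith

/-- the possible small distances -/
def Gd (β d : ℝ) : Prop := (∃ i : ℕ, 1 ≤ i ∧ d = 1 - (β⁻¹) ^ i) ∨ 1 ≤ d

theorem Gd_le (β : ℝ) (hβ1 : 1 < β) (d : ℝ) (h : Gd β d) : 1 - β⁻¹ ≤ d := by
  have hb : 0 < β⁻¹ := by positivity
  have hb1 : β⁻¹ < 1 := inv_lt_one_of_one_lt₀ hβ1
  rcases h with ⟨i, hi, rfl⟩ | h
  · have := pow_le_of_le_one hb.le hb1.le (n := i) (by omega)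
    linarith
  · linarith

/-- distances in `Ys` -/
theorem Ys_gap (m : ℕ) (hm : 1 ≤ m) (β : ℝ) (hβ1 : 1 < β) (hg : β + 1 ≤ β ^ 2)
    (hq : β - 1 = 1 - (β⁻¹) ^ m) (n : ℕ) :
    ∀ x ∈ Ys β n, ∀ y ∈ Ys β n, x < y → Gd β (y - x) := by
  have hbb : β * β⁻¹ = 1 := mul_inv_cancel₀ (by positivity)
  have hb : 0 < β⁻¹ := by positivity
  have hinv : β - β⁻¹ ≥ 1 := by nlinarith
  have hd1 : Gd β (β - 1) := Or.inl ⟨m, hm, hq⟩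
  induction n with
  | zero => intro x hx y hy h; simp [Ys] at hx hy; subst hx hy; exact absurd h (lt_irrefl _)
  | succ n ih =>
    -- same class distances
    have same : ∀ a ∈ Ys β n, ∀ b ∈ Ys β n, a < b → Gd β (β * (b - a)) := by
      intro a ha b hb' hab
      rcases ih a ha b hb' hab with ⟨i, hi, h⟩ | h
      · rw [h]
        obtain ⟨k, rfl⟩ : ∃ k, i = k + 1 := ⟨i - 1, by omega⟩
        have e : β * (1 - β⁻¹ ^ (k + 1)) = (β - 1) + (1 - β⁻¹ ^ k) := by
          rw [pow_succ]; linear_combination (-β⁻¹ ^ k) * hbb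
        rw [e]
        rcases Nat.eq_zero_or_pos k with rfl | hk
        · simpa using hd1
        · right
          have := Gd_le β hβ1 _ (Or.inl ⟨k, hk, rfl⟩)
          linarith
      · right; nlinarith
    rintro x ⟨a, ha, hx⟩ y ⟨b, hb', hy⟩ hxy
    have key : ∀ a ∈ Ys β n, ∀ b ∈ Ys β n, a < b → 1 - β⁻¹ ≤ b - a :=
      fun a ha b hb hab => Gd_le β hβ1 _ (ih a ha b hb hab)
    rcases hx with rfl | rfl <;> rcases hy with rfl | rfl
    · have : a < b := by nlinarith
      rw [← mul_sub]; exact same a ha b hb' this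
    · rcases lt_trichotomy a b with h | h | h
      · have := key a ha b hb' h
        right; nlinarith
      · subst h; simpa using hd1
      · have := key b hb' a ha h
        nlinarith
    · have hab : a < b := by nlinarith
      rcases ih a ha b hb' hab with ⟨i, hi, h⟩ | h
      · obtain ⟨k, rfl⟩ : ∃ k, i = k + 1 := ⟨i - 1, by omega⟩
        have e : β * b - (β * a + (β - 1)) = 1 - β⁻¹ ^ k := by
          have : b = a + (1 - β⁻¹ ^ (k + 1)) := by linarith
          rw [this, pow_succ]; linear_combination (-β⁻¹ ^ k) * hbb
        rcases Nat.eq_zero_or_pos k with rfl | hk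
        · simp at e; linarith
        · rw [e]; exact Or.inl ⟨k, hk, rfl⟩
      · right; nlinarith
    · have : a < b := by nlinarith
      have e : β * b + (β - 1) - (β * a + (β - 1)) = β * (b - a) := by ring
      rw [e]; exact same a ha b hb' this

/-- three points span at least one -/
theorem Ys_triple (m : ℕ) (hm : 1 ≤ m) (β : ℝ) (hβ1 : 1 < β) (hg : β + 1 ≤ β ^ 2)
    (hq : β - 1 = 1 - (β⁻¹) ^ m) (n : ℕ) :
    ∀ x ∈ Ys β n, ∀ y ∈ Ys β n, ∀ z ∈ Ys β n, x < y → y < z → 1 ≤ z - x := by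
  have hbb : β * β⁻¹ = 1 := mul_inv_cancel₀ (by positivity)
  have hb : 0 < β⁻¹ := by positivity
  have hinv : β - β⁻¹ ≥ 1 := by nlinarith
  induction n with
  | zero =>
    intro x hx y hy z hz h
    simp [Ys] at hx hy; subst hx hy; exact absurd h (lt_irrefl _)
  | succ n ih =>
    intro x hx y hy z hz hxy hyz
    have key : ∀ a ∈ Ys β n, ∀ b ∈ Ys β n, a < b → 1 - β⁻¹ ≤ b - a :=
      fun a ha b hb hab => Gd_le β hβ1 _ (Ys_gap m hm β hβ1 hg hq n a ha b hb hab)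
    have key' : ∀ a ∈ Ys β n, ∀ b ∈ Ys β n, a < b → β - 1 ≤ β * b - β * a := by
      intro a ha b hb hab
      have := key a ha b hb hab
      nlinarith
    have k1 := Gd_le β hβ1 _ (Ys_gap m hm β hβ1 hg hq (n+1) x hx y hy hxy)
    have k2 := Gd_le β hβ1 _ (Ys_gap m hm β hβ1 hg hq (n+1) y hy z hz hyz)
    obtain ⟨a, ha, hx⟩ := hx
    obtain ⟨b, hb', hy⟩ := hy
    obtain ⟨c, hc, hz⟩ := hz
    have hab : ∀ u v : ℝ, β * u < β * v → u < v := fun u v h => by nlinarith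
    rcases hx with rfl | rfl <;> rcases hy with rfl | rfl <;> rcases hz with rfl | rfl
    · have := key' a ha b hb' (hab _ _ hxy); linarith
    · have := key' a ha b hb' (hab _ _ hxy); linarith
    · rcases lt_trichotomy a b with h | h | h
      · rcases lt_or_ge b c with h' | h'
        · have := ih a ha b hb' c hc h h'; nlinarith
        · nlinarith
      · subst h; linarith
      · have := key' b hb' a ha h; linarith
    · have := key' b hb' c hc (hab _ _ (by linarith)); linarith
    · have := key' b hb' c hc (hab _ _ (by linarith)); linarith
    · have h : a < b := hab _ _ (by linarith)
      rcases lt_trichotomy b c with h' | h' | h'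
      · have := ih a ha b hb' c hc h h'; nlinarith
      · subst h'; linarith
      · have := key' c hc b hb' h'; linarith
    · have := key' a ha b hb' (hab _ _ (by linarith)); linarith
    · have := key' a ha b hb' (hab _ _ (by linarith)); linarith

/-- next point -/
theorem Ys_next (m : ℕ) (hm : 1 ≤ m) (β : ℝ) (hβ1 : 1 < β) (hβ2 : β < 2) (hg : β + 1 ≤ β ^ 2)
    (hq : β - 1 = 1 - (β⁻¹) ^ m) (n : ℕ) :
    ∀ x ∈ Ys β n, x < β ^ n - 1 → ∃ y ∈ Ys β n, x < y ∧ y ≤ x + (β - 1) := by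
  have hbb : β * β⁻¹ = 1 := mul_inv_cancel₀ (by positivity)
  induction n with
  | zero => intro x hx h; simp [Ys] at hx; subst hx; simp at h
  | succ n ih =>
    rintro x ⟨a, ha, hx⟩ h
    rcases hx with rfl | rfl
    · exact ⟨β * a + (β - 1), ⟨a, ha, Or.inr rfl⟩, by linarith, le_rfl⟩
    · have e : β ^ (n + 1) = β * β ^ n := by ring
      rw [e] at h
      obtain ⟨b, hb, hab, hb2⟩ := ih a ha (by nlinarith)
      have k := Gd_le β hβ1 _ (Ys_gap m hm β hβ1 hg hq n a ha b hb hab)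
      rcases k.eq_or_lt with k | k
      · have : b = a + (1 - β⁻¹) := by linarith
        have e2 : β * b = β * a + (β - 1) := by rw [this]; linear_combination -hbb
        exact ⟨β * b + (β - 1), ⟨b, hb, Or.inr rfl⟩, by linarith, by linarith⟩
      · exact ⟨β * b, ⟨b, hb, Or.inl rfl⟩, by nlinarith, by nlinarith⟩

theorem Sapply_eq (β : ℝ) (hβ1 : 1 < β) {n : ℕ} (I : Fin n → Fin 2) (x : ℝ) :
    Sapply β I x = x / β ^ n + ∑ k, (if I k = 0 then 0 else (1 - 1 / β) / β ^ (k : ℕ)) := by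
  have hb : β ≠ 0 := by positivity
  induction n with
  | zero => simp [Sapply]
  | succ n ih =>
    rw [Sapply, ih, Fin.sum_univ_succ, Smap]
    have e : ∑ i : Fin n, (if I i.succ = 0 then 0 else (1 - 1 / β) / β ^ ((i.succ : Fin (n+1)) : ℕ))
        = (∑ k : Fin n, (if I k.succ = 0 then 0 else (1 - 1 / β) / β ^ (k : ℕ))) / β := by
      rw [Finset.sum_div]
      refine Finset.sum_congr rfl fun k _ => ?_
      split_ifs
      · simp
      · rw [Fin.val_succ, pow_succ, div_div]
    rw [e, add_div, div_div, ← pow_succ]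
    split_ifs <;> simp <;> ring

theorem Sapply_aff (β : ℝ) (hβ1 : 1 < β) {n : ℕ} (I : Fin n → Fin 2) (x : ℝ) :
    Sapply β I x = Sapply β I 0 + x / β ^ n := by
  rw [Sapply_eq β hβ1 I x, Sapply_eq β hβ1 I 0]; ring

theorem mem_Ys (β : ℝ) (hβ1 : 1 < β) (n : ℕ) (y : ℝ) :
    y ∈ Ys β n ↔ ∃ I : Fin n → Fin 2, Sapply β I 0 * β ^ n = y := by
  have hb : β ≠ 0 := by positivity
  have step : ∀ n : ℕ, ∀ I : Fin (n+1) → Fin 2, Sapply β I 0 * β ^ (n+1) =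
      β * (Sapply β (fun k : Fin n => I k.castSucc) 0 * β ^ n) +
        (if I (Fin.last n) = 0 then 0 else β - 1) := by
    intro n I
    rw [Sapply_eq β hβ1 I, Sapply_eq β hβ1 (fun k : Fin n => I k.castSucc), Fin.sum_univ_castSucc]
    simp only [Fin.val_castSucc, Fin.val_last, zero_div, zero_add]
    split_ifs
    · ring
    · have : (1 - 1 / β) / β ^ n * β ^ (n+1) = β - 1 := by
        rw [pow_succ]; field_simp
      rw [add_mul, this]; ring
  induction n generalizing y with
  | zero =>
    simp [Ys, Sapply, eq_comm]
  | succ n ih =>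
    constructor
    · rintro ⟨x, hx, h⟩
      obtain ⟨J, rfl⟩ := (ih x).1 hx
      rcases h with rfl | rfl
      · refine ⟨Fin.snoc (α := fun _ => Fin 2) J 0, ?_⟩
        rw [step]; simp
      · refine ⟨Fin.snoc (α := fun _ => Fin 2) J 1, ?_⟩
        rw [step]; simp
    · rintro ⟨I, rfl⟩
      refine ⟨_, (ih _).2 ⟨fun k : Fin n => I k.castSucc, rfl⟩, ?_⟩
      rw [step]
      split_ifs
      · left; ring
      · right; rfl

section meas

variable (β p1 p2 : ℝ) (μ : Measure ℝ)

theorem Smap_meas (i : Fin 2) : Measurable (Smap β i) := by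
  unfold Smap
  split_ifs <;> fun_prop

theorem mu_step [IsProbabilityMeasure μ] (hp1 : 0 < p1) (hp2 : 0 < p2)
    (hμ : μ = ENNReal.ofReal p1 • μ.map (Smap β 0) + ENNReal.ofReal p2 • μ.map (Smap β 1))
    (A : Set ℝ) (hA : MeasurableSet A) :
    μ.real A = p1 * μ.real (Smap β 0 ⁻¹' A) + p2 * μ.real (Smap β 1 ⁻¹' A) := by
  have h : μ A = ENNReal.ofReal p1 * μ (Smap β 0 ⁻¹' A)
      + ENNReal.ofReal p2 * μ (Smap β 1 ⁻¹' A) := by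
    conv_lhs => rw [hμ]
    simp [Measure.map_apply (Smap_meas β _) hA]
  unfold Measure.real
  rw [h, ENNReal.toReal_add (by finiteness) (by finiteness), ENNReal.toReal_mul,
    ENNReal.toReal_mul, ENNReal.toReal_ofReal hp1.le, ENNReal.toReal_ofReal hp2.le]

theorem mu_iter [IsProbabilityMeasure μ]
    (hs : ∀ A : Set ℝ, MeasurableSet A →
      μ.real A = p1 * μ.real (Smap β 0 ⁻¹' A) + p2 * μ.real (Smap β 1 ⁻¹' A)) (n : ℕ) :
    ∀ A : Set ℝ, MeasurableSet A →
    μ.real A = ∑ I : Fin n → Fin 2, (∏ k, pw p1 p2 (I k)) * μ.real (Sapply β I ⁻¹' A) := by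
  induction n with
  | zero =>
    intro A hA
    have : ∀ I : Fin 0 → Fin 2, Sapply β I ⁻¹' A = A := fun I => by ext x; simp [Sapply]
    simp [this]
  | succ n ih =>
    intro A hA
    rw [hs A hA, ih _ (Smap_meas β 0 hA), ih _ (Smap_meas β 1 hA),
      ← (Fin.consEquiv fun _ : Fin (n+1) => Fin 2).sum_comp, Fintype.sum_prod_type,
      Fin.sum_univ_two, Finset.mul_sum, Finset.mul_sum]
    congr 1 <;>
    · refine Finset.sum_congr rfl fun J _ => ?_
      rw [Fin.prod_univ_succ, ← mul_assoc]
      congr 1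

end meas
section meas2

theorem Smap0 (β : ℝ) (x : ℝ) : Smap β 0 x = x / β := by simp [Smap]
theorem Smap1 (β : ℝ) (x : ℝ) : Smap β 1 x = x / β + (1 - 1 / β) := by simp [Smap]

theorem Smap1' (β : ℝ) (hβ1 : 1 < β) (x : ℝ) : β * (1 - Smap β 1 x) = 1 - x := by
  have : β ≠ 0 := by positivity
  rw [Smap1]; field_simp; ring

theorem Smap0' (β : ℝ) (hβ1 : 1 < β) (x : ℝ) : β * Smap β 0 x = x := by
  have : β ≠ 0 := by positivity
  rw [Smap0]; field_simp

/-- a set function that grows along dilation and shrinks to zero must vanish -/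
theorem tail_zero (g : ℝ → ℝ) (β : ℝ) (hβ1 : 1 < β) (μ : Measure ℝ) [IsProbabilityMeasure μ]
    (hg : Measurable g)
    (h : ∀ s > 0, μ.real {x | s < g x} ≤ μ.real {x | β * s < g x}) :
    μ.real {x | 0 < g x} = 0 := by
  have hlim : Filter.Tendsto (fun n : ℕ => μ.real {x | (n : ℝ) < g x}) Filter.atTop (nhds 0) := by
    have := tendsto_measure_iInter_atTop (μ := μ) (s := fun n : ℕ => {x | (n : ℝ) < g x})
      (fun n => (measurableSet_lt measurable_const hg).nullMeasurableSet)
      (fun a b hab x (hx : (b : ℝ) < g x) =>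
        (lt_of_le_of_lt (Nat.cast_le.2 hab) hx : (a : ℝ) < g x))
      ⟨0, by finiteness⟩
    have e : (⋂ n : ℕ, {x | (n : ℝ) < g x}) = ∅ := by
      ext x
      simp only [Set.mem_iInter, Set.mem_ofPred_eq, Set.mem_empty_iff_false, iff_false, not_forall,
        not_lt]
      obtain ⟨n, hn⟩ := exists_nat_ge (g x)
      exact ⟨n, hn⟩
    rw [e, measure_empty] at this
    simpa [Measure.real, Function.comp_def] using (ENNReal.tendsto_toReal ENNReal.zero_ne_top).comp this
  have hz : ∀ s > 0, μ.real {x | s < g x} = 0 := by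
    intro s hs
    refine le_antisymm ?_ measureReal_nonneg
    refine ge_of_tendsto hlim (Filter.Eventually.of_forall fun N => ?_)
    have hk : ∀ k : ℕ, μ.real {x | s < g x} ≤ μ.real {x | β ^ k * s < g x} := by
      intro k
      induction k with
      | zero => simp
      | succ k ih =>
        refine ih.trans ((h _ (by positivity)).trans (le_of_eq ?_))
        rw [pow_succ', mul_assoc]
    obtain ⟨k, hk'⟩ := pow_unbounded_of_one_lt ((N : ℝ) / s) hβ1
    refine (hk k).trans (measureReal_mono fun x hx => ?_)
    have : (N : ℝ) < β ^ k * s := by rwa [div_lt_iff₀ hs] at hk'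
    exact this.trans hx
  have hu : {x | 0 < g x} = ⋃ n : ℕ, {x | 1 / ((n : ℝ) + 1) < g x} := by
    ext x
    simp only [Set.mem_ofPred_eq, Set.mem_iUnion]
    constructor
    · intro hx; exact exists_nat_one_div_lt hx
    · rintro ⟨n, hn⟩; exact lt_trans (by positivity) hn
  rw [measureReal_eq_zero_iff, hu, measure_iUnion_null_iff]
  intro n
  exact (measureReal_eq_zero_iff).1 (hz _ (by positivity))

theorem gt_one_null (β p1 p2 : ℝ) (hβ1 : 1 < β) (hp1 : 0 < p1) (hp2 : 0 < p2)
    (hp : p1 + p2 = 1) (μ : Measure ℝ) [IsProbabilityMeasure μ]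
    (hs : ∀ A : Set ℝ, MeasurableSet A →
      μ.real A = p1 * μ.real (Smap β 0 ⁻¹' A) + p2 * μ.real (Smap β 1 ⁻¹' A)) : μ.real {x | 0 < x - 1} = 0 := by
  refine tail_zero (fun x => x - 1) β hβ1 μ (by fun_prop) fun s hs0 => ?_
  rw [hs _ (measurableSet_lt measurable_const (by fun_prop))]
  have h0 : μ.real (Smap β 0 ⁻¹' {x | s < x - 1}) ≤ μ.real {x | β * s < x - 1} := by
    refine measureReal_mono fun x hx => ?_
    have := Smap0' β hβ1 x
    simp only [Set.mem_preimage, Set.mem_ofPred_eq] at hx ⊢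
    nlinarith
  have h1 : μ.real (Smap β 1 ⁻¹' {x | s < x - 1}) ≤ μ.real {x | β * s < x - 1} := by
    refine measureReal_mono fun x hx => ?_
    have := Smap1' β hβ1 x
    simp only [Set.mem_preimage, Set.mem_ofPred_eq] at hx ⊢
    nlinarith
  refine (add_le_add (mul_le_mul_of_nonneg_left h0 hp1.le)
    (mul_le_mul_of_nonneg_left h1 hp2.le)).trans (le_of_eq ?_)
  rw [← add_mul, hp, one_mul]

theorem lt_zero_null (β p1 p2 : ℝ) (hβ1 : 1 < β) (hp1 : 0 < p1) (hp2 : 0 < p2)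
    (hp : p1 + p2 = 1) (μ : Measure ℝ) [IsProbabilityMeasure μ]
    (hs : ∀ A : Set ℝ, MeasurableSet A →
      μ.real A = p1 * μ.real (Smap β 0 ⁻¹' A) + p2 * μ.real (Smap β 1 ⁻¹' A)) : μ.real {x | 0 < -x} = 0 := by
  refine tail_zero (fun x => -x) β hβ1 μ (by fun_prop) fun s hs0 => ?_
  rw [hs _ (measurableSet_lt measurable_const (by fun_prop))]
  have h0 : μ.real (Smap β 0 ⁻¹' {x | s < -x}) ≤ μ.real {x | β * s < -x} := by
    refine measureReal_mono fun x hx => ?_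
    have := Smap0' β hβ1 x
    simp only [Set.mem_preimage, Set.mem_ofPred_eq] at hx ⊢
    nlinarith
  have h1 : μ.real (Smap β 1 ⁻¹' {x | s < -x}) ≤ μ.real {x | β * s < -x} := by
    refine measureReal_mono fun x hx => ?_
    have := Smap1' β hβ1 x
    simp only [Set.mem_preimage, Set.mem_ofPred_eq] at hx ⊢
    nlinarith
  refine (add_le_add (mul_le_mul_of_nonneg_left h0 hp1.le)
    (mul_le_mul_of_nonneg_left h1 hp2.le)).trans (le_of_eq ?_)
  rw [← add_mul, hp, one_mul]

theorem ge_one_null (β p1 p2 : ℝ) (hβ1 : 1 < β) (hp1 : 0 < p1) (hp2 : 0 < p2)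
    (hp : p1 + p2 = 1) (μ : Measure ℝ) [IsProbabilityMeasure μ]
    (hs : ∀ A : Set ℝ, MeasurableSet A →
      μ.real A = p1 * μ.real (Smap β 0 ⁻¹' A) + p2 * μ.real (Smap β 1 ⁻¹' A)) : μ.real (Set.Ici 1) = 0 := by
  have hg := gt_one_null β p1 p2 hβ1 hp1 hp2 hp μ hs
  have h := hs (Set.Ici 1) measurableSet_Ici
  have h0 : μ.real (Smap β 0 ⁻¹' Set.Ici 1) ≤ μ.real {x | 0 < x - 1} := by
    refine measureReal_mono fun x hx => ?_
    have := Smap0' β hβ1 x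
    simp only [Set.mem_preimage, Set.mem_ofPred_eq, Set.mem_Ici] at hx ⊢
    nlinarith
  have h1 : μ.real (Smap β 1 ⁻¹' Set.Ici 1) ≤ μ.real (Set.Ici 1) := by
    refine measureReal_mono fun x hx => ?_
    have := Smap1' β hβ1 x
    simp only [Set.mem_preimage, Set.mem_Ici] at hx ⊢
    nlinarith
  have hn : 0 ≤ μ.real (Set.Ici 1) := measureReal_nonneg
  have hp' : p2 = 1 - p1 := by linarith
  rw [hg] at h0
  nlinarith

theorem le_zero_null (β p1 p2 : ℝ) (hβ1 : 1 < β) (hp1 : 0 < p1) (hp2 : 0 < p2)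
    (hp : p1 + p2 = 1) (μ : Measure ℝ) [IsProbabilityMeasure μ]
    (hs : ∀ A : Set ℝ, MeasurableSet A →
      μ.real A = p1 * μ.real (Smap β 0 ⁻¹' A) + p2 * μ.real (Smap β 1 ⁻¹' A)) : μ.real (Set.Iic 0) = 0 := by
  have hg := lt_zero_null β p1 p2 hβ1 hp1 hp2 hp μ hs
  have h := hs (Set.Iic 0) measurableSet_Iic
  have h0 : μ.real (Smap β 0 ⁻¹' Set.Iic 0) ≤ μ.real (Set.Iic 0) := by
    refine measureReal_mono fun x hx => ?_
    have := Smap0' β hβ1 x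
    simp only [Set.mem_preimage, Set.mem_Iic] at hx ⊢
    nlinarith
  have h1 : μ.real (Smap β 1 ⁻¹' Set.Iic 0) ≤ μ.real {x | 0 < -x} := by
    refine measureReal_mono fun x hx => ?_
    have := Smap1' β hβ1 x
    simp only [Set.mem_preimage, Set.mem_ofPred_eq, Set.mem_Iic] at hx ⊢
    nlinarith
  have hn : 0 ≤ μ.real (Set.Iic 0) := measureReal_nonneg
  have hp' : p1 = 1 - p2 := by linarith
  rw [hg] at h1
  nlinarith

theorem unit_full (β p1 p2 : ℝ) (hβ1 : 1 < β) (hp1 : 0 < p1) (hp2 : 0 < p2)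
    (hp : p1 + p2 = 1) (μ : Measure ℝ) [IsProbabilityMeasure μ]
    (hs : ∀ A : Set ℝ, MeasurableSet A →
      μ.real A = p1 * μ.real (Smap β 0 ⁻¹' A) + p2 * μ.real (Smap β 1 ⁻¹' A)) : 1 ≤ μ.real (Set.Icc 0 1) := by
  have h0 := ge_one_null β p1 p2 hβ1 hp1 hp2 hp μ hs
  have h1 := le_zero_null β p1 p2 hβ1 hp1 hp2 hp μ hs
  have hu : (Set.univ : Set ℝ) ⊆ (Set.Iic 0 ∪ Set.Ici 1) ∪ Set.Icc 0 1 := by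
    intro x _
    simp only [Set.mem_union, Set.mem_Iic, Set.mem_Ici, Set.mem_Icc]
    rcases le_total x 0 with h | h <;> rcases le_total x 1 with h' | h' <;> tauto
  have a := measureReal_mono (μ := μ) hu
  have b := measureReal_union_le (μ := μ) (Set.Iic (0:ℝ) ∪ Set.Ici 1) (Set.Icc 0 1)
  have c := measureReal_union_le (μ := μ) (Set.Iic (0:ℝ)) (Set.Ici 1)
  have d : μ.real Set.univ = 1 := by simp
  linarith

theorem left_pos (β p1 p2 : ℝ) (hβ1 : 1 < β) (hp1 : 0 < p1) (hp2 : 0 < p2)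
    (hp : p1 + p2 = 1) (μ : Measure ℝ) [IsProbabilityMeasure μ]
    (hs : ∀ A : Set ℝ, MeasurableSet A →
      μ.real A = p1 * μ.real (Smap β 0 ⁻¹' A) + p2 * μ.real (Smap β 1 ⁻¹' A)) (c : ℝ) (hc : 0 < c) : 0 < μ.real (Set.Icc 0 c) := by
  have hk : ∀ k : ℕ, ∀ t : ℝ, 1 ≤ β ^ k * t → p1 ^ k ≤ μ.real (Set.Icc 0 t) := by
    intro k
    induction k with
    | zero =>
      intro t ht
      refine (by simpa using unit_full β p1 p2 hβ1 hp1 hp2 hp μ hs : p1 ^ 0 ≤ _).trans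
        (measureReal_mono (Set.Icc_subset_Icc_right (by simpa using ht)))
    | succ k ih =>
      intro t ht
      have h := ih (β * t) (by rw [← mul_assoc, ← pow_succ]; exact ht)
      rw [hs _ measurableSet_Icc]
      have h0 : μ.real (Set.Icc 0 (β * t)) ≤ μ.real (Smap β 0 ⁻¹' Set.Icc 0 t) := by
        refine measureReal_mono fun x hx => ?_
        have := Smap0' β hβ1 x
        simp only [Set.mem_preimage, Set.mem_Icc] at hx ⊢
        constructor <;> nlinarith
      have h1 : 0 ≤ μ.real (Smap β 1 ⁻¹' Set.Icc 0 t) := measureReal_nonneg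
      rw [pow_succ']
      have := mul_le_mul_of_nonneg_left (h.trans h0) hp1.le
      have := mul_nonneg hp2.le h1
      linarith
  obtain ⟨k, hk'⟩ := pow_unbounded_of_one_lt (1 / c) hβ1
  rw [div_lt_iff₀ hc] at hk'
  exact lt_of_lt_of_le (by positivity) (hk k c hk'.le)

theorem right_pos (β p1 p2 : ℝ) (hβ1 : 1 < β) (hp1 : 0 < p1) (hp2 : 0 < p2)
    (hp : p1 + p2 = 1) (μ : Measure ℝ) [IsProbabilityMeasure μ]
    (hs : ∀ A : Set ℝ, MeasurableSet A →
      μ.real A = p1 * μ.real (Smap β 0 ⁻¹' A) + p2 * μ.real (Smap β 1 ⁻¹' A)) (c : ℝ) (hc : 0 < c) : 0 < μ.real (Set.Icc (1 - c) 1) := by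
  have hk : ∀ k : ℕ, ∀ t : ℝ, 1 ≤ β ^ k * t → p2 ^ k ≤ μ.real (Set.Icc (1 - t) 1) := by
    intro k
    induction k with
    | zero =>
      intro t ht
      refine (by simpa using unit_full β p1 p2 hβ1 hp1 hp2 hp μ hs : p2 ^ 0 ≤ _).trans
        (measureReal_mono (Set.Icc_subset_Icc_left (by simpa using ht)))
    | succ k ih =>
      intro t ht
      have h := ih (β * t) (by rw [← mul_assoc, ← pow_succ]; exact ht)
      rw [hs _ measurableSet_Icc]
      have h0 : μ.real (Set.Icc (1 - β * t) 1) ≤ μ.real (Smap β 1 ⁻¹' Set.Icc (1 - t) 1) := by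
        refine measureReal_mono fun x hx => ?_
        have := Smap1' β hβ1 x
        simp only [Set.mem_preimage, Set.mem_Icc] at hx ⊢
        constructor <;> nlinarith
      have h1 : 0 ≤ μ.real (Smap β 0 ⁻¹' Set.Icc (1 - t) 1) := measureReal_nonneg
      rw [pow_succ']
      have := mul_le_mul_of_nonneg_left (h.trans h0) hp2.le
      have := mul_nonneg hp1.le h1
      linarith
  obtain ⟨k, hk'⟩ := pow_unbounded_of_one_lt (1 / c) hβ1
  rw [div_lt_iff₀ hc] at hk'
  exact lt_of_lt_of_le (by positivity) (hk k c hk'.le)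

end meas2

theorem pt_lt (β : ℝ) (n i j : ℕ) (hij : i < j) (hj : j < (Xn β n).card) :
    pt β n i < pt β n j := by
  have hl : ((Xn β n).sort (· ≤ ·)).length = (Xn β n).card := Finset.length_sort _
  unfold pt
  rw [List.getD_eq_getElem _ _ (by omega), List.getD_eq_getElem _ _ (by omega)]
  exact (Finset.sortedLT_sort (Xn β n)).strictMono_get (a := ⟨i, by omega⟩) (b := ⟨j, by omega⟩) hij

theorem pt_mem (β : ℝ) (n j : ℕ) (hj : j < (Xn β n).card) : pt β n j ∈ Xn β n := by
  have hl : ((Xn β n).sort (· ≤ ·)).length = (Xn β n).card := Finset.length_sort _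
  unfold pt
  rw [List.getD_eq_getElem _ _ (by omega)]
  exact (Finset.mem_sort (· ≤ ·)).1 (List.getElem_mem _)

theorem pt_surj (β : ℝ) (n : ℕ) (y : ℝ) (hy : y ∈ Xn β n) :
    ∃ i, i < (Xn β n).card ∧ pt β n i = y := by
  have hl : ((Xn β n).sort (· ≤ ·)).length = (Xn β n).card := Finset.length_sort _
  obtain ⟨i, hi, h⟩ := List.getElem_of_mem ((Finset.mem_sort (· ≤ ·)).2 hy)
  refine ⟨i, by omega, ?_⟩
  unfold pt
  rw [List.getD_eq_getElem _ _ hi, h]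

/-- there is `C' > 0` such that for every triple
`(x₀,x₁,x₂) = (a_{n,j}, a_{n,j+1}, a_{n,j+2})` in `X_n` (`n ≥ 2`, `0 ≤ j ≤ #X_n - 3`),
`C'·(W_n(x₀)+W_n(x₁)) ≤ μ_p([x₁,x₂]) ≤ W_n(x₀)+W_n(x₁)`. -/
theorem stmt_7 (m : ℕ) (hm : 2 ≤ m) (β : ℝ) (hβ1 : 1 < β) (hβ2 : β < 2)
    (hβ : β ^ m = ∑ j ∈ Finset.range m, β ^ j)
    (p1 p2 : ℝ) (hp1 : 0 < p1) (hp2 : 0 < p2) (hp : p1 + p2 = 1)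
    (μ : Measure ℝ) [IsProbabilityMeasure μ]
    (hμ : μ = ENNReal.ofReal p1 • μ.map (Smap β 0) + ENNReal.ofReal p2 • μ.map (Smap β 1)) :
    ∃ C' : ℝ, 0 < C' ∧ ∀ n, 2 ≤ n → ∀ j, j + 2 < (Xn β n).card →
      C' * (Wn β p1 p2 n (pt β n j) + Wn β p1 p2 n (pt β n (j+1))) ≤
        (μ (Set.Icc (pt β n (j+1)) (pt β n (j+2)))).toReal ∧
      (μ (Set.Icc (pt β n (j+1)) (pt β n (j+2)))).toReal ≤
        Wn β p1 p2 n (pt β n j) + Wn β p1 p2 n (pt β n (j+1)) := by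
  have hg := golden_le m hm β hβ1 hβ
  have hq := beta_sub_one m β hβ1 hβ
  have hm1 : 1 ≤ m := by omega
  have hs := mu_step β p1 p2 μ hp1 hp2 hμ
  have hinv : β⁻¹ < 1 := inv_lt_one_of_one_lt₀ hβ1
  have L := left_pos β p1 p2 hβ1 hp1 hp2 hp μ hs (1 - β⁻¹) (by linarith)
  have R := right_pos β p1 p2 hβ1 hp1 hp2 hp μ hs (2 - β) (by linarith)
  refine ⟨min (μ.real (Set.Icc 0 (1 - β⁻¹))) (μ.real (Set.Icc (1 - (2 - β)) 1)), lt_min L R, ?_⟩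
  set C := min (μ.real (Set.Icc 0 (1 - β⁻¹))) (μ.real (Set.Icc (1 - (2 - β)) 1)) with hC
  intro n _ j hj
  have h01 := pt_lt β n j (j+1) (by omega) (by omega)
  have h12 := pt_lt β n (j+1) (j+2) (by omega) hj
  have m0 := pt_mem β n j (by omega)
  have m1 := pt_mem β n (j+1) (by omega)
  have m2 := pt_mem β n (j+2) hj
  have hB : 0 < β ^ n := by positivity
  -- position of other points
  have pos : ∀ y ∈ Xn β n, y < pt β n j ∨ y = pt β n j ∨ y = pt β n (j+1) ∨ pt β n (j+2) ≤ y := by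
    intro y hy
    obtain ⟨i, hi, rfl⟩ := pt_surj β n y hy
    rcases lt_or_ge i j with h | h
    · exact Or.inl (pt_lt β n i j h (by omega))
    · rcases Nat.eq_or_lt_of_le h with h | h
      · subst h; simp
      · rcases Nat.eq_or_lt_of_le (Nat.succ_le_of_lt h) with h | h
        · subst h; simp
        · rcases Nat.eq_or_lt_of_le (Nat.succ_le_of_lt h) with h | h
          · subst h; simp
          · exact Or.inr (Or.inr (Or.inr (pt_lt β n (j+2) i (by omega) hi).le))
  -- scaled membership
  have sc : ∀ y ∈ Xn β n, y * β ^ n ∈ Ys β n ∨ y = 1 := by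
    intro y hy
    simp only [Xn, Finset.mem_union, Finset.mem_image, Finset.mem_univ, true_and,
      Finset.mem_singleton] at hy
    rcases hy with ⟨I, rfl⟩ | h
    · exact Or.inl ((mem_Ys β hβ1 n _).2 ⟨I, rfl⟩)
    · exact Or.inr h
  have le1 : ∀ y ∈ Xn β n, y ≤ 1 := by
    intro y hy
    rcases sc y hy with h | h
    · have := (Ys_bound β hβ1 n _ h).2
      nlinarith
    · exact h.le
  generalize hx0 : pt β n j = x0 at *
  generalize hx1 : pt β n (j+1) = x1 at *
  generalize hx2 : pt β n (j+2) = x2 at *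
  have l2 := le1 x2 m2
  have y0 : x0 * β ^ n ∈ Ys β n := (sc x0 m0).resolve_right (by linarith)
  have y1 : x1 * β ^ n ∈ Ys β n := (sc x1 m1).resolve_right (by linarith)
  have s01 : x0 * β ^ n < x1 * β ^ n := by nlinarith
  have s12 : x1 * β ^ n < x2 * β ^ n := by nlinarith
  have b1 := Ys_bound β hβ1 n _ y1
  have b0 := Ys_bound β hβ1 n _ y0
  -- gap facts
  have g01 : x1 * β ^ n - x0 * β ^ n ≤ β - 1 := by
    obtain ⟨z, hz, hz1, hz2⟩ := Ys_next m hm1 β hβ1 hβ2 hg hq n _ y0 (by linarith)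
    obtain ⟨I, rfl⟩ := (mem_Ys β hβ1 n z).1 hz
    have hlt : x0 < Sapply β I 0 := by nlinarith
    have hX : Sapply β I 0 ∈ Xn β n := by
      simp [Xn]
    have hge : x1 ≤ Sapply β I 0 := by
      rcases pos _ hX with h | h | h | h <;> linarith
    nlinarith
  have g02 : 1 ≤ x2 * β ^ n - x0 * β ^ n := by
    rcases sc x2 m2 with h | h
    · exact Ys_triple m hm1 β hβ1 hg hq n _ y0 _ y1 _ h s01 s12
    · rw [h]; linarith
  have g12 : 1 - β⁻¹ ≤ x2 * β ^ n - x1 * β ^ n := by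
    rcases sc x2 m2 with h | h
    · exact Gd_le β hβ1 _ (Ys_gap m hm1 β hβ1 hg hq n _ y1 _ h s12)
    · rw [h]
      have : 0 < β⁻¹ := by positivity
      linarith
  -- preimage
  have pre : ∀ I : Fin n → Fin 2, Sapply β I ⁻¹' Set.Icc x1 x2 =
      Set.Icc (x1 * β ^ n - Sapply β I 0 * β ^ n) (x2 * β ^ n - Sapply β I 0 * β ^ n) := by
    intro I
    ext x
    rw [Set.mem_preimage, Sapply_aff β hβ1 I x, Set.mem_Icc, Set.mem_Icc,
      ← mul_le_mul_iff_left₀ hB, ← mul_le_mul_iff_left₀ (b := Sapply β I 0 + x / β ^ n) hB,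
      add_mul, div_mul_cancel₀ _ hB.ne']
    constructor <;> rintro ⟨h1, h2⟩ <;> constructor <;> linarith
  have hpw : ∀ I : Fin n → Fin 2, 0 ≤ ∏ k, pw p1 p2 (I k) := by
    intro I
    refine Finset.prod_nonneg fun k _ => ?_
    unfold pw
    split_ifs <;> linarith
  have G1 := ge_one_null β p1 p2 hβ1 hp1 hp2 hp μ hs
  have G0 := le_zero_null β p1 p2 hβ1 hp1 hp2 hp μ hs
  have term : ∀ I : Fin n → Fin 2,
      C * ((if Sapply β I 0 = x0 then ∏ k, pw p1 p2 (I k) else 0) +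
        (if Sapply β I 0 = x1 then ∏ k, pw p1 p2 (I k) else 0)) ≤
        (∏ k, pw p1 p2 (I k)) * μ.real (Sapply β I ⁻¹' Set.Icc x1 x2) ∧
      (∏ k, pw p1 p2 (I k)) * μ.real (Sapply β I ⁻¹' Set.Icc x1 x2) ≤
        ((if Sapply β I 0 = x0 then ∏ k, pw p1 p2 (I k) else 0) +
        (if Sapply β I 0 = x1 then ∏ k, pw p1 p2 (I k) else 0)) := by
    intro I
    rw [pre]
    have hX : Sapply β I 0 ∈ Xn β n := by simp [Xn]
    have hY : Sapply β I 0 * β ^ n ∈ Ys β n := (mem_Ys β hβ1 n _).2 ⟨I, rfl⟩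
    have hw := hpw I
    generalize (∏ k, pw p1 p2 (I k)) = w at *
    generalize Sapply β I 0 = y at *
    have zero_case : y ≠ x0 → y ≠ x1 →
        μ.real (Set.Icc (x1 * β ^ n - y * β ^ n) (x2 * β ^ n - y * β ^ n)) ≤ 0 →
        C * ((if y = x0 then w else 0) + (if y = x1 then w else 0)) ≤
        w * μ.real (Set.Icc (x1 * β ^ n - y * β ^ n) (x2 * β ^ n - y * β ^ n)) ∧
        w * μ.real (Set.Icc (x1 * β ^ n - y * β ^ n) (x2 * β ^ n - y * β ^ n)) ≤
        ((if y = x0 then w else 0) + (if y = x1 then w else 0)) := by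
      intro h0 h1 h
      have : μ.real (Set.Icc (x1 * β ^ n - y * β ^ n) (x2 * β ^ n - y * β ^ n)) = 0 :=
        le_antisymm h measureReal_nonneg
      simp [h0, h1, this]
    have le_one : μ.real (Set.Icc (x1 * β ^ n - y * β ^ n) (x2 * β ^ n - y * β ^ n)) ≤ 1 :=
      measureReal_le_one
    rcases pos y hX with h | h | h | h
    · refine zero_case (by linarith) (by intro h'; linarith) ?_
      rw [← G1]
      have hlt : y * β ^ n < x0 * β ^ n := by nlinarith
      have := Ys_triple m hm1 β hβ1 hg hq n _ hY _ y0 _ y1 hlt s01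
      exact measureReal_mono fun x hx => this.trans hx.1
    · subst h
      rw [if_pos rfl, if_neg h01.ne, add_zero, mul_comm C w]
      refine ⟨mul_le_mul_of_nonneg_left ((min_le_right _ _).trans ?_) hw,
        mul_le_of_le_one_right hw le_one⟩
      exact measureReal_mono (Set.Icc_subset_Icc (by linarith) g02)
    · subst h
      rw [if_pos rfl, if_neg h01.ne', zero_add, mul_comm C w]
      refine ⟨mul_le_mul_of_nonneg_left ((min_le_left _ _).trans ?_) hw,
        mul_le_of_le_one_right hw le_one⟩
      exact measureReal_mono (Set.Icc_subset_Icc (by linarith) g12)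
    · refine zero_case (by intro h'; linarith) (by intro h'; linarith) ?_
      rw [← G0]
      have hle : x2 * β ^ n ≤ y * β ^ n := by nlinarith
      exact measureReal_mono fun x hx => hx.2.trans (by linarith)
  have main := mu_iter β p1 p2 μ hs n (Set.Icc x1 x2) measurableSet_Icc
  change C * (Wn β p1 p2 n x0 + Wn β p1 p2 n x1) ≤ μ.real (Set.Icc x1 x2) ∧
    μ.real (Set.Icc x1 x2) ≤ Wn β p1 p2 n x0 + Wn β p1 p2 n x1
  rw [main, Wn, Wn, ← Finset.sum_add_distrib, Finset.mul_sum]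
  exact ⟨Finset.sum_le_sum fun I _ => (term I).1, Finset.sum_le_sum fun I _ => (term I).2⟩
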